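/- arXiv:2105.04622 — 7 statements merged into one kernel-verified Lean document; each statement's English description precedes it below -/
import Mathlib

section
/- Let K be an algebraically closed field of characteristic zero, let C be a K-good category, let B be an object of C, and let T ∈ End_C(B). Then the power series ∑_{i≥0} Tr(T^i) X^i ∈ K[[X]] is a rational function of the form P(X)/Q(X), i.e. there exist polynomials P, Q ∈ K[X] with deg(P) ≤ deg(Q), Q squarefree (no multiple roots), Q(0) ≠ 0, and Q(X)·∑_{i≥0} Tr(T^i) X^i = P(X) in K[[X]]. -/
open CategoryTheory MonoidalCategory

/-- The categorical trace of an endomorphism `f : X ⟶ X` in a rigid symmetric monoidal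
category: the composite
`𝟙_ C ⟶ X ⊗ Xᘁ ⟶ X ⊗ Xᘁ ⟶ Xᘁ ⊗ X ⟶ 𝟙_ C`
of the coevaluation, `f ⊗ 𝟙`, the symmetry, and the evaluation. -/
noncomputable def catTrace {C : Type*} [Category C] [MonoidalCategory C]
    [BraidedCategory C] [RightRigidCategory C] {X : C} (f : X ⟶ X) :
    𝟙_ C ⟶ 𝟙_ C :=
  η_ X Xᘁ ≫ (f ▷ Xᘁ) ≫ (β_ X Xᘁ).hom ≫ ε_ X Xᘁ

/-- The categorical trace is cyclic. -/
theorem catTrace_comp_comm {C : Type*} [Category C] [MonoidalCategory C]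
    [BraidedCategory C] [RightRigidCategory C] {X Y : C} (f : X ⟶ Y) (g : Y ⟶ X) :
    catTrace (f ≫ g) = catTrace (g ≫ f) := by
  have h₁ : (g ▷ Xᘁ) ≫ (β_ X Xᘁ).hom = (β_ Y Xᘁ).hom ≫ (Xᘁ ◁ g) :=
    BraidedCategory.braiding_naturality_left g Xᘁ
  have h₂ : (Y ◁ rightAdjointMate f) ≫ (β_ Y Xᘁ).hom =
      (β_ Y Yᘁ).hom ≫ (rightAdjointMate f ▷ Y) :=
    BraidedCategory.braiding_naturality_right Y (rightAdjointMate f)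
  have h₃ : ((g ≫ f) ▷ Yᘁ) ≫ (β_ Y Yᘁ).hom = (β_ Y Yᘁ).hom ≫ (Yᘁ ◁ (g ≫ f)) :=
    BraidedCategory.braiding_naturality_left (g ≫ f) Yᘁ
  calc catTrace (f ≫ g)
      = (η_ X Xᘁ ≫ f ▷ Xᘁ) ≫ ((g ▷ Xᘁ) ≫ (β_ X Xᘁ).hom) ≫ ε_ X Xᘁ := by
        simp only [catTrace, comp_whiskerRight, Category.assoc]
    _ = η_ Y Yᘁ ≫ ((Y ◁ rightAdjointMate f) ≫ (β_ Y Xᘁ).hom) ≫ (Xᘁ ◁ g) ≫ ε_ X Xᘁ := by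
        rw [← coevaluation_comp_rightAdjointMate, h₁]
        simp only [Category.assoc]
    _ = η_ Y Yᘁ ≫ (β_ Y Yᘁ).hom ≫ (Yᘁ ◁ g) ≫ (rightAdjointMate f ▷ X) ≫ ε_ X Xᘁ := by
        rw [h₂, Category.assoc, ← whisker_exchange_assoc]
    _ = η_ Y Yᘁ ≫ (((g ≫ f) ▷ Yᘁ) ≫ (β_ Y Yᘁ).hom) ≫ ε_ Y Yᘁ := by
        rw [rightAdjointMate_comp_evaluation, h₃]
        simp only [MonoidalCategory.whiskerLeft_comp, Category.assoc]
    _ = catTrace (g ≫ f) := by simp only [catTrace, Category.assoc]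

/-- The categorical trace as a linear map. -/
noncomputable def catTraceLinearMap (K : Type*) [Field K] {C : Type*} [Category C]
    [Preadditive C] [Linear K C] [MonoidalCategory C] [MonoidalPreadditive C]
    [MonoidalLinear K C] [BraidedCategory C] [RightRigidCategory C] (X : C) :
    CategoryTheory.End X →ₗ[K] (𝟙_ C ⟶ 𝟙_ C) where
  toFun f := catTrace (f : X ⟶ X)
  map_add' f g := by
    change catTrace ((f : X ⟶ X) + (g : X ⟶ X)) = _
    rw [catTrace, MonoidalPreadditive.add_whiskerRight, Preadditive.add_comp, Preadditive.comp_add]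
    rfl
  map_smul' a f := by
    change catTrace (a • (f : X ⟶ X)) = _
    rw [catTrace, MonoidalLinear.smul_whiskerRight, Linear.smul_comp, Linear.comp_smul]
    rfl

theorem factorThruImage_comp_pow_comp_image_ι {C : Type*} [Category C] [Abelian C] {X : C}
    (f : CategoryTheory.End X) (n : ℕ) :
    Limits.factorThruImage (f : X ⟶ X) ≫
      (HPow.hPow (α := CategoryTheory.End (Limits.image (f : X ⟶ X)))
        (Limits.image.ι (f : X ⟶ X) ≫ Limits.factorThruImage (f : X ⟶ X)) n :
        CategoryTheory.End (Limits.image (f : X ⟶ X))) ≫ Limits.image.ι (f : X ⟶ X) =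
      (f ^ (n + 1) : CategoryTheory.End X) := by
  induction n with
  | zero =>
    rw [pow_zero, zero_add, pow_one, End.one_def]
    simp
  | succ n ih =>
    rw [pow_succ (f : CategoryTheory.End X), ← ih, pow_succ, End.mul_def, End.mul_def]
    simp

/-- A nilpotent endomorphism has zero categorical trace. -/
theorem catTrace_eq_zero_of_isNilpotent_s4 {C : Type*} [Category C] [Abelian C]
    [MonoidalCategory C] [MonoidalPreadditive C] [BraidedCategory C] [RightRigidCategory C]
    {X : C} {f : CategoryTheory.End X} (hf : IsNilpotent f) :
    catTrace (f : X ⟶ X) = 0 := by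
  obtain ⟨n, hn⟩ := hf
  induction n generalizing X with
  | zero =>
    have h : (f : X ⟶ X) = 0 := by
      have : f = 0 := by rw [← mul_one f, ← pow_zero f, hn, mul_zero]
      exact this
    rw [h]
    simp [catTrace]
  | succ n ih =>
    rw [← Limits.image.fac (f : X ⟶ X), catTrace_comp_comm]
    apply ih
    have h := factorThruImage_comp_pow_comp_image_ι f n
    rw [hn] at h
    exact Limits.zero_of_comp_mono _ (Limits.zero_of_epi_comp _ h)

open Polynomial in
theorem Polynomial.reverse_reverse_dvd {K : Type*} [Field K] (r : K[X]) :
    r.reverse.reverse ∣ r := by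
  have hle := r.natTrailingDegree_le_natDegree
  refine ⟨X ^ r.natTrailingDegree, ?_⟩
  ext n
  rw [coeff_mul_X_pow', coeff_reverse, coeff_reverse, reverse_natDegree]
  split_ifs with h
  · by_cases hn : n ≤ r.natDegree
    · rw [revAt_le (N := r.natDegree - _) (by lia), revAt_le (by lia)]
      congr 1
      lia
    · rw [revAt_eq_self_of_lt (N := r.natDegree - _) (by lia), ← coeff_reverse,
        coeff_eq_zero_of_natDegree_lt (by lia), coeff_eq_zero_of_natDegree_lt]
      rw [reverse_natDegree]
      lia
  · exact coeff_eq_zero_of_lt_natTrailingDegree (by lia)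

open Polynomial in
theorem Polynomial.squarefree_reverse {K : Type*} [Field K] {r : K[X]} (hr : Squarefree r) :
    Squarefree r.reverse := by
  have hr0 : r ≠ 0 := hr.ne_zero
  rintro a ⟨b, hb⟩
  have ha0 : a.coeff 0 ≠ 0 := by
    intro h
    have h1 : r.reverse.coeff 0 = 0 := by
      rw [hb, mul_coeff_zero, mul_coeff_zero, h, zero_mul, zero_mul]
    rw [coeff_zero_reverse] at h1
    exact hr0 (leadingCoeff_eq_zero.1 h1)
  have hdvd : a.reverse * a.reverse ∣ r := by
    refine Dvd.dvd.trans ?_ (reverse_reverse_dvd r)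
    exact ⟨b.reverse, by rw [hb, reverse_mul_of_domain, reverse_mul_of_domain]⟩
  have hu := natDegree_eq_zero_of_isUnit (hr _ hdvd)
  rw [reverse_natDegree, natTrailingDegree_eq_zero.2 (Or.inr ha0), Nat.sub_zero] at hu
  rw [eq_C_of_natDegree_eq_zero hu]
  exact isUnit_C.2 ha0.isUnit

open Polynomial in
theorem Polynomial.natTrailingDegree_le_one_of_squarefree {K : Type*} [Field K] {r : K[X]}
    (hr : Squarefree r) : r.natTrailingDegree ≤ 1 := by
  by_contra! h
  have h1 : (X : K[X]) * X ∣ r := by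
    rw [← pow_two, X_pow_dvd_iff]
    intro d hd
    exact coeff_eq_zero_of_lt_natTrailingDegree (hd.trans_le h)
  exact not_isUnit_X (hr _ h1)

open Polynomial in
theorem coeff_reverse_mul_mk_eq {K A : Type*} [Field K] [Ring A] [Algebra K A]
    (t : A →ₗ[K] K) (T : A) (r : K[X]) (m : ℕ) :
    PowerSeries.coeff (m + r.natDegree)
      ((r.reverse : PowerSeries K) * PowerSeries.mk fun i => t (T ^ i)) =
      t (aeval T r * T ^ m) := by
  rw [PowerSeries.coeff_mul, Finset.Nat.sum_antidiagonal_eq_sum_range_succ_mk,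
    ← Finset.sum_subset (Finset.range_mono (show r.natDegree + 1 ≤ (m + r.natDegree).succ by lia)),
    ← Finset.sum_range_reflect, aeval_eq_sum_range, Finset.sum_mul, map_sum]
  · refine Finset.sum_congr rfl fun i hi => ?_
    have hi' : i ≤ r.natDegree := by simpa [Nat.lt_succ_iff] using hi
    rw [coeff_coe, PowerSeries.coeff_mk, coeff_reverse, revAt_le (by lia), smul_mul_assoc,
      ← pow_add, map_smul, smul_eq_mul]
    congr 3 <;> lia
  · intro i _ hi
    have hi' : r.natDegree < i := by simpa using hi
    rw [coeff_coe, coeff_eq_zero_of_natDegree_lt (r.reverse_natDegree_le.trans_lt hi'), zero_mul]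

open Polynomial UniqueFactorizationMonoid in
/-- For a linear functional on a finite-dimensional algebra vanishing on nilpotents, the
generating series of its values on the powers of an element is `P / Q` with `deg P ≤ deg Q`,
`Q` squarefree and `Q(0) ≠ 0`. -/
theorem exists_rational_mk_apply_pow {K A : Type*} [Field K] [Ring A] [Algebra K A]
    [FiniteDimensional K A] (t : A →ₗ[K] K) (ht : ∀ a, IsNilpotent a → t a = 0) (T : A) :
    ∃ P Q : K[X], P.degree ≤ Q.degree ∧ Squarefree Q ∧ Q.eval 0 ≠ 0 ∧
      (Q : PowerSeries K) * PowerSeries.mk (fun i => t (T ^ i)) = (P : PowerSeries K) := by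
  classical
  set r := radical (minpoly K T)
  have hr : Squarefree r := squarefree_radical
  have hnil : IsNilpotent (aeval T r) := by
    obtain ⟨n, hn⟩ := exists_dvd_radical_self_pow
      (minpoly.ne_zero (Algebra.IsIntegral.isIntegral (R := K) T))
    exact ⟨n, by rw [← map_pow]; exact (minpoly.dvd_iff).1 hn⟩
  set F : PowerSeries K := (r.reverse : PowerSeries K) * PowerSeries.mk fun i => t (T ^ i)
  have hQ0 : r.reverse.eval 0 ≠ 0 := by
    rw [← coeff_zero_eq_eval_zero, coeff_zero_reverse]
    exact leadingCoeff_ne_zero.2 hr.ne_zero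
  have hQ : r.reverse ≠ 0 := fun h => hr.ne_zero (by simpa using h)
  refine ⟨PowerSeries.trunc r.natDegree F, r.reverse, ?_, squarefree_reverse hr, hQ0, ?_⟩
  · have h := natTrailingDegree_le_one_of_squarefree hr
    rw [degree_eq_natDegree hQ, reverse_natDegree, degree_le_iff_coeff_zero]
    intro m hm
    have hm' : r.natDegree - r.natTrailingDegree < m := by exact_mod_cast hm
    rw [PowerSeries.coeff_trunc, if_neg (by lia)]
  · ext n
    rw [coeff_coe, PowerSeries.coeff_trunc]
    split_ifs with h
    · rfl
    · obtain ⟨m, rfl⟩ := Nat.exists_eq_add_of_le' (not_lt.1 h)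
      rw [coeff_reverse_mul_mk_eq]
      refine ht _ (Commute.isNilpotent_mul_right ?_ hnil)
      have h : Commute (aeval T r) (aeval T (X ^ m)) := (Commute.all r (X ^ m)).map (aeval T)
      rwa [map_pow, aeval_X] at h

/-- Let `K` be an algebraically closed field of characteristic zero, `C` a
`K`-good category (a `K`-linear abelian rigid symmetric monoidal category with
finite-dimensional hom-spaces in which `K → End (𝟙_ C)`, `a ↦ a • 𝟙`, is bijective),
`B` an object of `C` and `T ∈ End B`. Then, reading the traces `Tr (Tⁱ)` as scalars
`τ i ∈ K` via the bijection `K ≅ End (𝟙_ C)`, the power series `∑ τ i • Xⁱ ∈ K[[X]]` is a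
rational function `P(X)/Q(X)` with `deg P ≤ deg Q`, `Q` squarefree and `Q(0) ≠ 0`. -/
theorem catTrace_powerSeries_is_good_rational
    (K : Type*) [Field K] [IsAlgClosed K] [CharZero K]
    (C : Type*) [Category C] [Abelian C] [Linear K C]
    [MonoidalCategory C] [MonoidalPreadditive C] [MonoidalLinear K C]
    [SymmetricCategory C] [RigidCategory C]
    [∀ X Y : C, FiniteDimensional K (X ⟶ Y)]
    (hK : Function.Bijective fun a : K => (a • 𝟙 (𝟙_ C) : 𝟙_ C ⟶ 𝟙_ C))
    (B : C) (T : CategoryTheory.End B) :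
    ∃ τ : ℕ → K,
      (∀ i : ℕ, τ i • 𝟙 (𝟙_ C) = catTrace ((T ^ i : CategoryTheory.End B) : B ⟶ B)) ∧
      ∃ P Q : Polynomial K, P.degree ≤ Q.degree ∧ Squarefree Q ∧ Q.eval 0 ≠ 0 ∧
        (Q : PowerSeries K) * PowerSeries.mk τ = (P : PowerSeries K) := by
  let e : K →ₗ[K] (𝟙_ C ⟶ 𝟙_ C) := LinearMap.toSpanSingleton K _ (𝟙 (𝟙_ C))
  let E : K ≃ₗ[K] (𝟙_ C ⟶ 𝟙_ C) := LinearEquiv.ofBijective e hK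
  let t : CategoryTheory.End B →ₗ[K] K := E.symm.toLinearMap ∘ₗ catTraceLinearMap K B
  have : FiniteDimensional K (CategoryTheory.End B) :=
    inferInstanceAs (FiniteDimensional K (B ⟶ B))
  refine ⟨fun i => t (T ^ i), fun i => E.apply_symm_apply _, exists_rational_mk_apply_pow t ?_ T⟩
  intro a ha
  change E.symm (catTrace (a : B ⟶ B)) = 0
  rw [catTrace_eq_zero_of_isNilpotent_s4 ha, map_zero]
end

section
/- Let K be an algebraically closed field of characteristic zero, let C be a K-good category, let B be an object of C, and let T ∈ End_C(B) be nilpotent. Then Tr(T) = 0. -/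
open CategoryTheory MonoidalCategory

theorem catTrace_zero {C : Type*} [Category C] [Preadditive C] [MonoidalCategory C]
    [MonoidalPreadditive C] [BraidedCategory C] [RightRigidCategory C] (X : C) :
    catTrace (0 : X ⟶ X) = 0 := by
  simp [catTrace]

theorem CategoryTheory.End.comp_pow_comp {C : Type*} [Category C] {X Y : C}
    (f : X ⟶ Y) (g : Y ⟶ X) (n : ℕ) :
    f ≫ ((End.of (g ≫ f) ^ n : End Y) : Y ⟶ Y) ≫ g = (End.of (f ≫ g) ^ (n + 1) : End X) := by
  induction n with
  | zero => simp [End.of, End.one_def]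
  | succ n ih =>
    rw [pow_succ _ (n + 1), ← ih, pow_succ]
    simp [End.mul_def, End.of]

theorem catTrace_eq_zero_of_pow_eq_zero {C : Type*} [Category C] [Abelian C]
    [MonoidalCategory C] [MonoidalPreadditive C] [BraidedCategory C] [RightRigidCategory C]
    (n : ℕ) (X : C) (f : End X) (hf : f ^ (n + 1) = 0) : catTrace (f : X ⟶ X) = 0 := by
  induction n generalizing X with
  | zero =>
    rw [zero_add, pow_one] at hf
    rw [hf]
    exact catTrace_zero X
  | succ n ih =>
    let e := Limits.factorThruImage (f : X ⟶ X)
    let m := Limits.image.ι (f : X ⟶ X)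
    have hfac : e ≫ m = f := Limits.image.fac (f : X ⟶ X)
    have h := End.comp_pow_comp e m (n + 1)
    have hpow : (End.of (m ≫ e)) ^ (n + 1) = 0 := by
      rw [hfac] at h
      rw [← cancel_epi e, ← cancel_mono m, Category.assoc]
      exact (h.trans hf).trans (by simp)
    rw [← hfac, catTrace_comp_comm]
    exact ih _ _ hpow

/-- Let `K` be an algebraically closed field of characteristic zero, `C` a
`K`-good category (a `K`-linear abelian rigid symmetric monoidal category with
finite-dimensional hom-spaces in which `K → End (𝟙_ C)`, `a ↦ a • 𝟙`, is bijective),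
`B` an object of `C` and `T` a nilpotent endomorphism of `B`. Then `Tr T = 0`. -/
theorem catTrace_eq_zero_of_isNilpotent
    (K : Type*) [Field K] [IsAlgClosed K] [CharZero K]
    (C : Type*) [Category C] [Abelian C] [Linear K C]
    [MonoidalCategory C] [MonoidalPreadditive C] [MonoidalLinear K C]
    [SymmetricCategory C] [RigidCategory C]
    [∀ X Y : C, FiniteDimensional K (X ⟶ Y)]
    (hK : Function.Bijective fun a : K => (a • 𝟙 (𝟙_ C) : 𝟙_ C ⟶ 𝟙_ C))
    (B : C) (T : CategoryTheory.End B) (hT : IsNilpotent T) :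
    catTrace (T : B ⟶ B) = 0 := by
  obtain ⟨n, hn⟩ := hT
  exact catTrace_eq_zero_of_pow_eq_zero n B T (by rw [pow_succ, hn, zero_mul])
end

section
/- Let K be an algebraically closed field. For a formal power series f ∈ K[[X]], the following are equivalent: (i) there exist polynomials P, Q ∈ K[X] with deg(P) ≤ deg(Q), Q squarefree, Q(0) ≠ 0, and Q·f = P in K[[X]]; (ii) f lies in the K-linear span of the geometric series { ∑_{n≥0} λ^n X^n : λ ∈ K } inside K[[X]]. -/
open Polynomial in
/-- The factors `1 - aX` with `a ∈ s` have a separable product. -/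
theorem separable_prod_one_sub_C_mul_X {K : Type*} [Field K] (s : Finset K) :
    (∏ a ∈ s, (1 - C a * X : K[X])).Separable := by
  refine separable_prod' (fun a _ b _ hab => ?_) (fun a _ => ?_)
  · have hba : b - a ≠ 0 := sub_ne_zero.2 hab.symm
    refine ⟨C ((b - a)⁻¹ * b), -C ((b - a)⁻¹ * a), ?_⟩
    have h : (C (b - a)⁻¹ * (C b - C a) : K[X]) = 1 := by
      rw [← C_sub, ← C_mul, inv_mul_cancel₀ hba, C_1]
    simp only [C_mul]
    linear_combination h
  · refine ⟨1, -X, ?_⟩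
    simp only [derivative_sub, derivative_one, derivative_C_mul, derivative_X]
    ring

/-- The geometric series of ratio `a` is inverse to `1 - aX`. -/
theorem PowerSeries.one_sub_C_mul_X_mul_mk_pow {R : Type*} [CommRing R] (a : R) :
    (1 - C a * X) * (mk fun n => a ^ n) = 1 := by
  ext n
  cases n with
  | zero => simp [sub_mul, mul_assoc]
  | succ n => simp [sub_mul, mul_assoc, coeff_succ_X_mul, coeff_one, pow_succ']

open Polynomial in
/-- A combination of geometric series is a fraction with denominator `∏ (1 - aX)` whose numerator
has no larger degree. -/
theorem exists_prod_mul_sum_geometric_eq {K : Type*} [Field K] (s : Finset K) (c : K → K) :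
    ∃ P : K[X], P.degree ≤ (∏ a ∈ s, (1 - C a * X : K[X])).degree ∧
      ((∏ a ∈ s, (1 - C a * X : K[X]) : K[X]) : PowerSeries K) *
        ∑ a ∈ s, c a • (PowerSeries.mk fun n => a ^ n) = (P : PowerSeries K) := by
  classical
  induction s using Finset.induction_on with
  | empty => exact ⟨0, by simp, by simp⟩
  | insert a s ha ih =>
    obtain ⟨P, hP, h⟩ := ih
    set Q := ∏ a ∈ s, (1 - C a * X : K[X])
    have hne : (1 - C a * X : K[X]) ≠ 0 := fun h0 => by
      simpa using congrArg (eval 0) h0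
    refine ⟨(1 - C a * X) * P + C (c a) * Q, ?_, ?_⟩
    · rw [Finset.prod_insert ha]
      refine (degree_add_le _ _).trans (max_le ?_ ?_)
      · rw [degree_mul, degree_mul]
        gcongr
      · rw [← smul_eq_C_mul, mul_comm]
        refine (degree_smul_le _ _).trans ?_
        exact degree_le_mul_left _ hne
    · rw [Finset.prod_insert ha, Finset.sum_insert ha]
      have hg := PowerSeries.one_sub_C_mul_X_mul_mk_pow a
      simp only [Polynomial.coe_mul, Polynomial.coe_add, Polynomial.coe_sub, Polynomial.coe_one,
        Polynomial.coe_C, Polynomial.coe_X, PowerSeries.smul_eq_C_mul] at h ⊢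
      linear_combination (1 - PowerSeries.C a * PowerSeries.X) * h +
        PowerSeries.C (c a) * (Q : PowerSeries K) * hg

open Polynomial in
/-- A fraction with squarefree denominator that does not vanish at `0`, and numerator of no larger
degree, is a combination of geometric series. -/
theorem mem_span_geometric_of_mul_eq {K : Type*} [Field K] [IsAlgClosed K] (Q : K[X])
    (hQ : Squarefree Q) (hQ0 : Q.eval 0 ≠ 0) (P : K[X]) (hPQ : P.degree ≤ Q.degree)
    (f : PowerSeries K) (hf : (Q : PowerSeries K) * f = (P : PowerSeries K)) :
    f ∈ Submodule.span K {g : PowerSeries K | ∃ l : K, g = PowerSeries.mk fun n => l ^ n} := by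
  induction hn : Q.natDegree generalizing Q P f with
  | zero =>
    obtain ⟨q, rfl⟩ := natDegree_eq_zero.1 hn
    have hq : q ≠ 0 := by simpa using hQ0
    obtain ⟨p, rfl⟩ : ∃ p, C p = P :=
      natDegree_eq_zero.1 (Nat.le_zero.1 (hn ▸ natDegree_le_natDegree hPQ))
    have hfC : f = (q⁻¹ * p) • PowerSeries.mk fun n => (0 : K) ^ n := by
      have h0 := PowerSeries.one_sub_C_mul_X_mul_mk_pow (0 : K)
      have hinv : (PowerSeries.C q⁻¹ * PowerSeries.C q : PowerSeries K) = 1 := by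
        rw [← map_mul, inv_mul_cancel₀ hq, map_one]
      simp only [Polynomial.coe_C, map_zero, zero_mul, sub_zero, one_mul] at hf h0
      rw [h0, PowerSeries.smul_eq_C_mul, map_mul]
      linear_combination PowerSeries.C q⁻¹ * hf - f * hinv
    rw [hfC]
    exact Submodule.smul_mem _ _ (Submodule.subset_span ⟨0, rfl⟩)
  | succ n ih =>
    obtain ⟨α, hα⟩ := IsAlgClosed.exists_root Q fun h => by
      have h0 : Q.natDegree = 0 := natDegree_eq_of_degree_eq_some h
      omega
    obtain ⟨Q₁, rfl⟩ := dvd_iff_isRoot.2 hα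
    have hα0 : α ≠ 0 := by
      rintro rfl
      exact hQ0 hα
    have hQ₁ : Q₁ ≠ 0 := by
      rintro rfl
      simp at hQ0
    have hQ₁α : Q₁.eval α ≠ 0 := fun h => by
      obtain ⟨R, rfl⟩ := dvd_iff_isRoot.2 h
      exact not_isUnit_X_sub_C α (hQ _ ⟨R, by ring⟩)
    set c := -(P.eval α / (α * Q₁.eval α)) with hc
    obtain ⟨P₁, hP₁⟩ : X - C α ∣ P + C (c * α) * Q₁ := by
      rw [dvd_iff_isRoot, IsRoot, eval_add, eval_mul, eval_C, hc]
      field_simp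
      ring
    have hgeom : (PowerSeries.X - PowerSeries.C α) * (PowerSeries.mk fun n => α⁻¹ ^ n) =
        -PowerSeries.C α := by
      have hinv : (PowerSeries.C α * PowerSeries.C α⁻¹ : PowerSeries K) = 1 := by
        rw [← map_mul, mul_inv_cancel₀ hα0, map_one]
      linear_combination -PowerSeries.C α * PowerSeries.one_sub_C_mul_X_mul_mk_pow α⁻¹ -
        PowerSeries.X * (PowerSeries.mk fun n => α⁻¹ ^ n) * hinv
    have hdeg : P₁.degree ≤ Q₁.degree := by
      have h : ((X - C α) * P₁).degree ≤ ((X - C α) * Q₁).degree := by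
        rw [← hP₁]
        refine (degree_add_le _ _).trans (max_le hPQ ?_)
        rw [← smul_eq_C_mul, mul_comm (X - C α)]
        refine (degree_smul_le _ _).trans ?_
        exact degree_le_mul_left _ (X_sub_C_ne_zero α)
      rw [degree_mul, degree_mul, degree_X_sub_C] at h
      exact (WithBot.add_le_add_iff_left WithBot.one_ne_bot).1 h
    have hmul : (Q₁ : PowerSeries K) * (f - c • PowerSeries.mk fun n => α⁻¹ ^ n) = P₁ := by
      have hne : (PowerSeries.X - PowerSeries.C α : PowerSeries K) ≠ 0 := fun h => hα0 <| by
        simpa using congrArg PowerSeries.constantCoeff h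
      refine mul_left_cancel₀ hne ?_
      have h := congrArg (fun p : K[X] => (p : PowerSeries K)) hP₁
      simp only [Polynomial.coe_mul, Polynomial.coe_add, Polynomial.coe_sub, Polynomial.coe_C,
        Polynomial.coe_X, map_mul] at h hf
      rw [PowerSeries.smul_eq_C_mul]
      linear_combination hf + h - (Q₁ : PowerSeries K) * PowerSeries.C c * hgeom
    have hmem := ih Q₁ (hQ.squarefree_of_dvd (dvd_mul_left _ _))
      (fun h => hQ0 (by rw [eval_mul, h, mul_zero])) P₁ hdeg _ hmul (by
        rw [natDegree_mul (X_sub_C_ne_zero α) hQ₁, natDegree_X_sub_C] at hn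
        omega)
    rw [← sub_add_cancel f (c • PowerSeries.mk fun n => α⁻¹ ^ n)]
    exact add_mem hmem (Submodule.smul_mem _ _ (Submodule.subset_span ⟨α⁻¹, rfl⟩))

/-- Let `K` be an algebraically closed field. For a formal power series
`f ∈ K[[X]]`, the following are equivalent: (i) there exist polynomials `P, Q` with
`deg P ≤ deg Q`, `Q` squarefree, `Q(0) ≠ 0` and `Q · f = P` in `K[[X]]`; (ii) `f` lies in
the `K`-linear span of the geometric series `∑ λⁿ Xⁿ` for `λ ∈ K`. -/
theorem good_rational_iff_span_geometric
    (K : Type*) [Field K] [IsAlgClosed K] (f : PowerSeries K) :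
    (∃ P Q : Polynomial K, P.degree ≤ Q.degree ∧ Squarefree Q ∧ Q.eval 0 ≠ 0 ∧
        (Q : PowerSeries K) * f = (P : PowerSeries K))
      ↔ f ∈ Submodule.span K
          {g : PowerSeries K | ∃ l : K, g = PowerSeries.mk fun n => l ^ n} := by
  constructor
  · rintro ⟨P, Q, hPQ, hQ, hQ0, hf⟩
    exact mem_span_geometric_of_mul_eq Q hQ hQ0 P hPQ f hf
  · intro hf
    have hrange : {g : PowerSeries K | ∃ l : K, g = PowerSeries.mk fun n => l ^ n} =
        Set.range fun l : K => PowerSeries.mk fun n => l ^ n := by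
      ext g
      simp [eq_comm]
    rw [hrange, Finsupp.mem_span_range_iff_exists_finsupp] at hf
    obtain ⟨c, rfl⟩ := hf
    obtain ⟨P, hP, h⟩ := exists_prod_mul_sum_geometric_eq c.support c
    exact ⟨P, _, hP, (separable_prod_one_sub_C_mul_X _).squarefree,
      by simp [Polynomial.eval_prod], h⟩
end

section
/- Let K be a field, R a finite-dimensional K-algebra, and τ : R → K a K-linear functional such that τ(ab) = τ(ba) for all a,b ∈ R, the bilinear form (a,b) ↦ τ(ab) is non-degenerate, and τ(a) = 0 for every nilpotent element a ∈ R. Then R is semisimple. -/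
/-- Let `K` be a field, `R` a finite-dimensional `K`-algebra, and `τ : R → K` a
`K`-linear functional such that `τ (a b) = τ (b a)` for all `a b`, the bilinear form
`(a, b) ↦ τ (a b)` is non-degenerate, and `τ` vanishes on all nilpotent elements.
Then `R` is semisimple. -/
theorem isSemisimpleRing_of_trace_form
    (K : Type*) [Field K] (R : Type*) [Ring R] [Algebra K R] [FiniteDimensional K R]
    (τ : R →ₗ[K] K)
    (hcomm : ∀ a b : R, τ (a * b) = τ (b * a))
    (hnd : ∀ a : R, (∀ b : R, τ (a * b) = 0) → a = 0)
    (hnil : ∀ a : R, IsNilpotent a → τ a = 0) :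
    IsSemisimpleRing R := by
  have : IsArtinianRing R := IsArtinianRing.of_finite K R
  rw [IsArtinianRing.isSemisimpleRing_iff_jacobson, eq_bot_iff]
  intro a ha
  refine hnd a fun b ↦ hnil _ ?_
  obtain ⟨n, hn⟩ := IsSemiprimaryRing.isNilpotent (R := R)
  have hab : a * b ∈ Ring.jacobson R := Ideal.mul_mem_right b _ ha
  have hpow : (a * b) ^ n ∈ Ring.jacobson R ^ n := Ideal.pow_mem_pow hab n
  rw [hn] at hpow
  exact ⟨n, hpow⟩
end

section
/- Let K be an algebraically closed field of characteristic zero, R a finite-dimensional semisimple K-algebra, and f : R → K a K-linear functional satisfying f(ab) = f(ba) for all a,b ∈ R. Then f(a) = 0 for every nilpotent element a ∈ R. -/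
/-- A tracial linear functional on a matrix algebra vanishes on matrices of trace zero. -/
theorem Matrix.tracial_apply_eq_zero_of_trace_eq_zero {n K : Type*} [Fintype n] [DecidableEq n]
    [CommSemiring K] (g : Matrix n n K →ₗ[K] K)
    (hg : ∀ A B : Matrix n n K, g (A * B) = g (B * A))
    (A : Matrix n n K) (hA : A.trace = 0) : g A = 0 := by
  have hoff (i j : n) (hij : i ≠ j) (c : K) : g (Matrix.single i j c) = 0 := by
    have h := hg (Matrix.single i i 1) (Matrix.single i j c)
    simpa [hij.symm] using h
  have hdiag (i j : n) (c : K) : g (Matrix.single i i c) = c * g (Matrix.single j j 1) := by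
    have h := hg (Matrix.single i j c) (Matrix.single j i 1)
    rw [← smul_eq_mul, ← map_smul]
    simpa using h
  cases isEmpty_or_nonempty n with
  | inl _ => rw [Subsingleton.elim A 0, map_zero]
  | inr h =>
    obtain ⟨k⟩ := h
    have hsum : g A = ∑ i, g (Matrix.single i i (A i i)) := by
      conv_lhs => rw [Matrix.matrix_eq_sum_single A]
      simp only [map_sum]
      refine Finset.sum_congr rfl fun i _ => Finset.sum_eq_single i (fun j _ hj => ?_) (by simp)
      exact hoff i j hj.symm _
    rw [hsum, Finset.sum_congr rfl fun i _ => hdiag i k (A i i), ← Finset.sum_mul]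
    rw [show ∑ i, A i i = 0 from hA, zero_mul]

/-- Let `K` be an algebraically closed field of characteristic zero, `R` a
finite-dimensional semisimple `K`-algebra, and `f : R → K` a `K`-linear functional with
`f (a b) = f (b a)` for all `a b`. Then `f` vanishes on all nilpotent elements of `R`. -/
theorem linear_functional_vanishes_on_nilpotents
    (K : Type*) [Field K] [IsAlgClosed K] [CharZero K]
    (R : Type*) [Ring R] [Algebra K R] [FiniteDimensional K R] [IsSemisimpleRing R]
    (f : R →ₗ[K] K) (hf : ∀ a b : R, f (a * b) = f (b * a))
    (a : R) (ha : IsNilpotent a) :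
    f a = 0 := by
  obtain ⟨m, d, -, ⟨e⟩⟩ := IsSemisimpleRing.exists_algEquiv_pi_matrix_of_isAlgClosed K R
  have hblock (i : Fin m) :
      (f ∘ₗ e.symm.toLinearMap ∘ₗ
        LinearMap.single K (fun i => Matrix (Fin (d i)) (Fin (d i)) K) i) (e a i) = 0 := by
    apply Matrix.tracial_apply_eq_zero_of_trace_eq_zero
    · intro A B
      simp [Pi.single_mul, hf]
    · exact (Matrix.isNilpotent_trace_of_isNilpotent
        ((ha.map e).map (Pi.evalRingHom _ i))).eq_zero
  calc
    f a = f (e.symm (∑ i, Pi.single i (e a i))) := by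
      rw [Finset.univ_sum_single, e.symm_apply_apply]
    _ = ∑ i, f (e.symm (Pi.single i (e a i))) := by simp only [map_sum]
    _ = 0 := Finset.sum_eq_zero fun i _ => hblock i
end

section
/- Let K be a field and let C be a K-linear additive category with finite-dimensional hom-spaces. Let B₁, B₂ be objects with End_C(B₁) = K·id_{B₁} and End_C(B₂) = K·id_{B₂}, and suppose the endomorphism algebra End_C(B₁ ⊕ B₂) is a semisimple ring. If Hom_C(B₁, B₂) ≠ 0, then B₁ ≅ B₂. -/
open CategoryTheory CategoryTheory.Limits

/-- A semisimple ring is semiprime. -/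
theorem IsSemisimpleRing.exists_mul_mul_ne_zero {R : Type*} [Ring R] [IsSemisimpleRing R]
    {x : R} (hx : x ≠ 0) : ∃ y, x * y * x ≠ 0 := by
  by_contra! h
  have hmem : x ∈ Ring.jacobson R := by
    rw [← Ideal.jacobson_bot, Ideal.mem_jacobson_iff]
    refine fun y ↦ ⟨1 - y * x, ?_⟩
    have hyx : y * x * y * x = 0 := by simpa [mul_assoc] using congrArg (y * ·) (h y)
    simp [sub_mul, hyx]
  rw [Ring.jacobson, IsSemisimpleModule.jacobson_eq_bot] at hmem
  exact hx hmem

/-- If `End (X ⊞ Y)` is semisimple, for every nonzero `f : X ⟶ Y` there is `g : Y ⟶ X` with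
`f ≫ g ≫ f ≠ 0`. -/
theorem exists_comp_comp_ne_zero_of_semisimple_end
    {C : Type*} [Category C] [Preadditive C] {X Y : C} [HasBinaryBiproduct X Y]
    [IsSemisimpleRing (CategoryTheory.End (X ⊞ Y))] {f : X ⟶ Y} (hf : f ≠ 0) :
    ∃ g : Y ⟶ X, f ≫ g ≫ f ≠ 0 := by
  let x : CategoryTheory.End (X ⊞ Y) := biprod.fst ≫ f ≫ biprod.inr
  have hx : x ≠ 0 := fun h ↦ hf <| by
    have h' : biprod.inl ≫ (biprod.fst ≫ f ≫ biprod.inr) ≫ biprod.snd =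
        biprod.inl ≫ (0 : X ⊞ Y ⟶ X ⊞ Y) ≫ biprod.snd :=
      congrArg (fun t : X ⊞ Y ⟶ X ⊞ Y ↦ biprod.inl ≫ t ≫ biprod.snd) h
    simpa using h'
  obtain ⟨y, hy⟩ := IsSemisimpleRing.exists_mul_mul_ne_zero hx
  let y' : X ⊞ Y ⟶ X ⊞ Y := y
  refine ⟨biprod.inr ≫ y' ≫ biprod.fst, fun h ↦ hy ?_⟩
  change (biprod.fst ≫ f ≫ biprod.inr) ≫ y' ≫ biprod.fst ≫ f ≫ biprod.inr = 0
  simpa using congrArg (fun t ↦ biprod.fst ≫ t ≫ biprod.inr) h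

/-- Let `K` be a field and `C` a `K`-linear additive category with
finite-dimensional hom-spaces. Let `B₁, B₂` be objects with `End B₁ = K · 𝟙` and
`End B₂ = K · 𝟙`, and suppose `End (B₁ ⊞ B₂)` is a semisimple ring. If
`Hom (B₁, B₂) ≠ 0` then `B₁ ≅ B₂`. -/
theorem iso_of_hom_ne_zero_of_semisimple_end
    (K : Type*) [Field K] (C : Type*) [Category C] [Preadditive C] [Linear K C]
    [HasFiniteBiproducts C] [HasBinaryBiproducts C]
    [∀ X Y : C, FiniteDimensional K (X ⟶ Y)]
    (B₁ B₂ : C)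
    (h1 : ∀ f : B₁ ⟶ B₁, ∃ a : K, f = a • 𝟙 B₁)
    (h2 : ∀ f : B₂ ⟶ B₂, ∃ a : K, f = a • 𝟙 B₂)
    (hss : IsSemisimpleRing (CategoryTheory.End (B₁ ⊞ B₂)))
    (hne : ∃ f : B₁ ⟶ B₂, f ≠ 0) :
    Nonempty (B₁ ≅ B₂) := by
  obtain ⟨f, hf⟩ := hne
  obtain ⟨g, hg⟩ := exists_comp_comp_ne_zero_of_semisimple_end hf
  obtain ⟨a, ha⟩ := h1 (f ≫ g)
  obtain ⟨b, hb⟩ := h2 (g ≫ f)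
  have hfa : f ≫ g ≫ f = a • f := by rw [← Category.assoc, ha]; simp
  have hfb : f ≫ g ≫ f = b • f := by rw [hb]; simp
  have hab : a = b := smul_left_injective K hf (hfa.symm.trans hfb)
  have ha0 : a ≠ 0 := by
    rintro rfl
    exact hg (by simpa using hfa)
  exact ⟨{
    hom := f
    inv := a⁻¹ • g
    hom_inv_id := by rw [Linear.comp_smul, ha, inv_smul_smul₀ ha0]
    inv_hom_id := by rw [Linear.smul_comp, hb, ← hab, inv_smul_smul₀ ha0] }⟩
end

section
/- Let K be a field and let n, m ∈ ℕ. Consider the action of the symmetric group S_n on (K^n)^{⊗m} induced diagonally from the permutation action of S_n on the coordinates of K^n. Then the dimension of the subspace of S_n-invariant tensors in (K^n)^{⊗m} is at most the number of partitions of a set with m elements (equivalently, the number of equivalence relations on {1,…,m}). -/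
open scoped TensorProduct

/-- Two functions into a finite type with the same kernel differ by a permutation of the
codomain. -/
theorem Setoid.exists_perm_comp_eq_of_ker_eq {α β : Type*} [Finite β] {p q : α → β}
    (h : Setoid.ker p = Setoid.ker q) : ∃ σ : Equiv.Perm β, σ ∘ p = q := by
  classical
  have := Fintype.ofFinite β
  let e : {x // x ∈ Set.range p} ≃ {x // x ∈ Set.range q} :=
    (Setoid.quotientKerEquivRange p).symm.trans
      ((Quotient.congrRight fun a b => by rw [h]).trans (Setoid.quotientKerEquivRange q))
  refine ⟨e.extendSubtype, funext fun a => ?_⟩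
  have key : (Setoid.quotientKerEquivRange p).symm ⟨p a, a, rfl⟩ = Quotient.mk _ a := by
    rw [Equiv.symm_apply_eq]
    rfl
  rw [Function.comp_apply, Equiv.extendSubtype_apply_of_mem _ _ ⟨a, rfl⟩]
  simp only [e, Equiv.trans_apply, key]
  rfl

/-- Pulling back coordinates in every tensor factor permutes the coordinates of a tensor. -/
theorem PiTensorProduct.repr_map_funLeft {R ι κ : Type*} [CommSemiring R] [Fintype ι]
    [Finite κ] (f : κ → κ) (t : ⨂[R] _ : ι, κ → R) (p : ι → κ) :
    (Basis.piTensorProduct fun _ : ι => Pi.basisFun R κ).repr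
        (PiTensorProduct.map (fun _ : ι => LinearMap.funLeft R R f) t) p =
      (Basis.piTensorProduct fun _ : ι => Pi.basisFun R κ).repr t (f ∘ p) := by
  induction t using PiTensorProduct.induction_on with
  | smul_tprod r x =>
    simp [PiTensorProduct.map_tprod, Basis.piTensorProduct_repr_tprod_apply,
      LinearMap.funLeft_apply]
  | add x y hx hy => simp [hx, hy]

/-- Let `K` be a field and `n, m ∈ ℕ`. For the diagonal action of `Sₙ` on
`(Kⁿ)^{⊗ m}` induced from permuting the coordinates of `Kⁿ`, the dimension of the subspace
of `Sₙ`-invariant tensors is at most the number of equivalence relations on an `m`-element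
set (the `m`-th Bell number). -/
theorem finrank_symmetric_invariants_le_bell
    (K : Type*) [Field K] (n m : ℕ) :
    Module.finrank K
      ↥(⨅ σ : Equiv.Perm (Fin n),
          LinearMap.eqLocus
            (PiTensorProduct.map fun _ : Fin m => LinearMap.funLeft K K σ.symm)
            LinearMap.id)
      ≤ Nat.card (Setoid (Fin m)) := by
  classical
  have : Finite (Setoid (Fin m)) :=
    Finite.of_injective (fun s : Setoid (Fin m) => s.r) fun s t h =>
      Setoid.ext fun a b => iff_of_eq (congrFun (congrFun h a) b)
  have := Fintype.ofFinite (Setoid (Fin m))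
  let B := Basis.piTensorProduct fun _ : Fin m => Pi.basisFun K (Fin n)
  let L : (⨂[K] _ : Fin m, Fin n → K) →ₗ[K] Setoid (Fin m) → K :=
    LinearMap.pi fun s =>
      if h : ∃ p : Fin m → Fin n, Setoid.ker p = s then B.coord h.choose else 0
  rw [Nat.card_eq_fintype_card, ← Module.finrank_fintype_fun_eq_card K]
  refine LinearMap.finrank_le_finrank_of_injective (f := L.domRestrict _) ?_
  rw [injective_iff_map_eq_zero]
  rintro ⟨t, ht⟩ h0
  rw [Submodule.mem_iInf] at ht
  refine Subtype.ext (B.ext_elem fun p => ?_)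
  have hp : ∃ q : Fin m → Fin n, Setoid.ker q = Setoid.ker p := ⟨p, rfl⟩
  obtain ⟨σ, hσ⟩ := Setoid.exists_perm_comp_eq_of_ker_eq hp.choose_spec.symm
  have hL : B.repr t hp.choose = 0 := by
    have := congrFun h0 (Setoid.ker p)
    simpa only [L, LinearMap.domRestrict_apply, LinearMap.pi_apply, dif_pos hp,
      Module.Basis.coord_apply, Pi.zero_apply] using this
  have hmap := PiTensorProduct.repr_map_funLeft (R := K) σ t p
  have hinv := ht σ.symm
  rw [LinearMap.mem_eqLocus, Equiv.symm_symm, LinearMap.id_apply] at hinv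
  rw [hinv, hσ] at hmap
  simpa using hmap.trans hL
end
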